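/- For every NPLCS N, location q and set of locations B ⊆ Q, the following are equivalent: (c.1) there exists a scheduler U with Pr_U((q,ε) ⊨ ◇□B) > 0; (c.2) there exists an almost blind, finite-memory scheduler U with Pr_U((q,ε) ⊨ ◇□B) > 0; (c.3) (q,ε) →* Safe(B), i.e., some configuration with location in Safe(B) is reachable from (q,ε). -/

import Mathlib

open scoped ENNReal
open Classical

namespace NPLCSmodel

/-! ## Lossy channel systems -/

/-- Operations of a lossy channel system: send a message on a channel,
receive a message from a channel, or an internal action. -/
inductive LcsOp (C M : Type) : Type where
  | send : C → M → LcsOp C M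
  | recv : C → M → LcsOp C M
  | internal : LcsOp C M

def LcsOp.IsRecv {C M : Type} : LcsOp C M → Prop
  | .recv _ _ => True
  | _ => False

/-- A transition rule `src --op--> dst`. -/
structure LcsRule (Q C M : Type) : Type where
  src : Q
  op : LcsOp C M
  dst : Q

/-- Channel contents: a word over `M` for each channel. -/
abbrev Chans (C M : Type) : Type := C → List M

/-- Configurations: a location together with channel contents. -/
abbrev Conf (Q C M : Type) : Type := Q × Chans C M

/-- The empty channel contents ε. -/
def eps (C M : Type) : Chans C M := fun _ => []

variable {Q C M : Type}

/-- When is an operation possible on channel contents `w`? -/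
def enabledOp : LcsOp C M → Chans C M → Prop
  | .recv c m, w => ∃ v, w c = m :: v
  | .send _ _, _ => True
  | .internal, _ => True

/-- Effect of an operation on the channel contents (for a perfect step). -/
def applyOp [DecidableEq C] : LcsOp C M → Chans C M → Chans C M
  | .send c m, w => Function.update w c (w c ++ [m])
  | .recv c _, w => Function.update w c (w c).tail
  | .internal, w => w

/-- A rule is enabled in a configuration. -/
def LcsRule.EnabledIn (δ : LcsRule Q C M) (s : Conf Q C M) : Prop :=
  δ.src = s.1 ∧ enabledOp δ.op s.2

/-- A lossy channel system `L = (Q, C, M, Δ)` (the finiteness of the location,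
channel and message types is imposed by `Fintype` assumptions at use sites):
a finite set of transition rules such that every location has at least one
outgoing rule that is not a receive. -/
structure LCS (Q C M : Type) : Type where
  rules : Set (LcsRule Q C M)
  finiteRules : rules.Finite
  noDeadlock : ∀ q : Q, ∃ δ ∈ rules, δ.src = q ∧ ¬ δ.op.IsRecv

variable [DecidableEq C]

/-- Lossy step via rule `δ`: a perfect step followed by losing arbitrarily
many messages (`<+` is the (componentwise) subword relation). -/
def LCS.StepVia (L : LCS Q C M) (s : Conf Q C M) (δ : LcsRule Q C M)
    (t : Conf Q C M) : Prop :=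
  δ ∈ L.rules ∧ δ.EnabledIn s ∧ t.1 = δ.dst ∧ ∀ c, List.Sublist (t.2 c) (applyOp δ.op s.2 c)

/-- Lossy step `s → t`. -/
def LCS.Step (L : LCS Q C M) (s t : Conf Q C M) : Prop := ∃ δ, L.StepVia s δ t

/-- Reachability `s →* t`. -/
def LCS.Reach (L : LCS Q C M) : Conf Q C M → Conf Q C M → Prop :=
  Relation.ReflTransGen L.Step

/-- Constrained reachability `s →*_[X) t`: all configurations along the path,
except possibly the last one, have their location in `X`. -/
def LCS.ReachWithin (L : LCS Q C M) (X : Set Q) : Conf Q C M → Conf Q C M → Prop :=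
  Relation.ReflTransGen (fun a b => L.Step a b ∧ a.1 ∈ X)

/-- Constrained reachability `s →*_[X] t`: all configurations along the path,
including `s` and `t`, have their location in `X`. -/
def LCS.ReachConstrained (L : LCS Q C M) (X : Set Q) (s t : Conf Q C M) : Prop :=
  L.ReachWithin X s t ∧ t.1 ∈ X

/-- `X` is safe for `A`. -/
def LCS.IsSafeFor (L : LCS Q C M) (A X : Set Q) : Prop :=
  X ⊆ A ∧ ∀ x ∈ X, ∃ t, L.Step (x, eps C M) t ∧ t.1 ∈ X

/-- `Safe(A)`: the largest set safe for `A` (the union of all such sets). -/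
def LCS.Safe (L : LCS Q C M) (A : Set Q) : Set Q := ⋃₀ {X | L.IsSafeFor A X}

/-- `X` is promising for `A`. -/
def LCS.IsPromisingFor (L : LCS Q C M) (A X : Set Q) : Prop :=
  ∀ x ∈ X, ∃ t, L.ReachWithin X (x, eps C M) t ∧ t.1 ∈ A

/-- `Prom(A)`: the largest set promising for `A` (the union of all such sets). -/
def LCS.Prom (L : LCS Q C M) (A : Set Q) : Set Q := ⋃₀ {X | L.IsPromisingFor A X}

/-! ## NPLCS and the induced Markov decision process -/

/-- An NPLCS: an LCS together with a fault rate `τ ∈ (0,1)`. -/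
structure NPLCS (Q C M : Type) : Type where
  L : LCS Q C M
  τ : ℝ
  τ_pos : 0 < τ
  τ_lt_one : τ < 1

/-- The number of embeddings of the second list as a subword of the first. -/
def countEmb [DecidableEq M] : List M → List M → ℕ
  | _, [] => 1
  | [], _ :: _ => 0
  | a :: v, b :: w => (if a = b then countEmb v w else 0) + countEmb v (b :: w)

variable [Fintype C] [DecidableEq M]

/-- Total number of messages in the channels. -/
def chansSize (w : Chans C M) : ℕ := ∑ c, (w c).length

/-- `P_lost(v,v') = τ^(|v|-|v'|) · (1-τ)^|v'| · C(v,v')`, the probability that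
channel contents `v` become `v'` through message losses. -/
noncomputable def plost (τ : ℝ) (v v' : Chans C M) : ℝ≥0∞ :=
  ENNReal.ofReal
    (τ ^ (chansSize v - chansSize v') * (1 - τ) ^ chansSize v' *
      (∏ c, countEmb (v c) (v' c) : ℕ))

/-- One-step probability `P_N(s, δ, t)` of the MDP of an NPLCS. -/
noncomputable def NPLCS.stepProb (N : NPLCS Q C M) (s : Conf Q C M)
    (δ : LcsRule Q C M) (t : Conf Q C M) : ℝ≥0∞ :=
  if δ ∈ N.L.rules ∧ δ.EnabledIn s ∧ t.1 = δ.dst then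
    plost N.τ (applyOp δ.op s.2) t.2
  else 0

/-! ## Probability measure of a countable-state Markov chain

Given one-step probabilities `k` on a state space `S`, the measure of a set of
trajectories is the Carathéodory outer measure generated by the probabilities
of cylinder sets; it agrees with the usual Markov-chain measure on all
measurable (in particular, on all ω-regular) sets of trajectories. -/

section Chain
variable {S : Type}

/-- Probability that the chain starting in `s` performs the finite sequence
of steps through the configurations listed in `l`. -/
noncomputable def chainPathProb (k : S → S → ℝ≥0∞) : S → List S → ℝ≥0∞
  | _, [] => 1
  | s, t :: l => k s t * chainPathProb k t l

/-- The cylinder of trajectories starting with `s` followed by `l`. -/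
def chainCyl (s : S) (l : List S) : Set (ℕ → S) :=
  {ω | ω 0 = s ∧ ∀ (i : ℕ) (h : i < l.length), ω (i + 1) = l.get ⟨i, h⟩}

/-- Premeasure: probability of a cylinder set, `∞` on other (nonempty) sets. -/
noncomputable def chainFun (k : S → S → ℝ≥0∞) (s : S) (A : Set (ℕ → S)) : ℝ≥0∞ :=
  if A = ∅ then 0 else ⨅ (l : List S) (_ : A = chainCyl s l), chainPathProb k s l

theorem chainFun_empty (k : S → S → ℝ≥0∞) (s : S) : chainFun k s ∅ = 0 := by
  simp [chainFun]

/-- The probability, for the Markov chain with one-step probabilities `k`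
started in `s`, of the set `E` of trajectories (paths starting in `s`). -/
noncomputable def chainPr (k : S → S → ℝ≥0∞) (s : S) (E : Set (ℕ → S)) : ℝ≥0∞ :=
  MeasureTheory.OuterMeasure.ofFunction (chainFun k s) (chainFun_empty k s)
    (E ∩ {ω | ω 0 = s})

end Chain

/-! ## Schedulers -/

/-- A (history-dependent, deterministic) scheduler: given the history
`h = s₁ → ⋯ → s_{n-1}` and the current configuration `sₙ`, it chooses a
transition rule of `N` enabled in `sₙ`. -/
structure Scheduler (N : NPLCS Q C M) : Type where
  choose : List (Conf Q C M) → Conf Q C M → LcsRule Q C M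
  choose_mem : ∀ h s, choose h s ∈ N.L.rules
  choose_enabled : ∀ h s, (choose h s).EnabledIn s

variable {N : NPLCS Q C M}

/-- The Markov chain `MC_U` induced by a scheduler: its states are finite
paths, represented as (history, current configuration). -/
noncomputable def Scheduler.kernel (U : Scheduler N) :
    List (Conf Q C M) × Conf Q C M → List (Conf Q C M) × Conf Q C M → ℝ≥0∞ :=
  fun a b =>
    if b.1 = a.1 ++ [a.2] then N.stepProb a.2 (U.choose a.1 a.2) b.2 else 0

/-- `Pr_U(s ⊨ E)`: the probability, under scheduler `U` with starting
configuration `s`, of the set `E` of infinite paths (trajectories of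
configurations). -/
noncomputable def Scheduler.Pr (U : Scheduler N) (s : Conf Q C M)
    (E : Set (ℕ → Conf Q C M)) : ℝ≥0∞ :=
  chainPr U.kernel ([], s) {ω | (fun i => (ω i).2) ∈ E}

/-- Memoryless scheduler: the decision depends only on the current
configuration. -/
def Scheduler.Memoryless (U : Scheduler N) : Prop :=
  ∀ h h' s, U.choose h s = U.choose h' s

/-- Blind scheduler: the decision depends only on the sequence of locations
that have been visited. -/
def Scheduler.Blind (U : Scheduler N) : Prop :=
  ∀ h h' s s', h.map Prod.fst = h'.map Prod.fst → s.1 = s'.1 →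
    U.choose h s = U.choose h' s'

/-- Finite-memory scheduler data: finitely many modes, a starting mode, a
decision rule and a next-mode function. -/
structure FMScheduler (N : NPLCS Q C M) : Type 1 where
  Mode : Type
  modeFin : Fintype Mode
  init : Mode
  D : Mode → Conf Q C M → LcsRule Q C M
  upd : Mode → Conf Q C M → Mode
  D_mem : ∀ u s, D u s ∈ N.L.rules
  D_enabled : ∀ u s, (D u s).EnabledIn s

/-- A scheduler is finite-memory if it is induced by finite-memory data. -/
def Scheduler.FiniteMemory (U : Scheduler N) : Prop :=
  ∃ fm : FMScheduler N, ∀ h s, U.choose h s = fm.D (h.foldl fm.upd fm.init) s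

/-- The Markov chain `MC_U` of a finite-memory scheduler: states are pairs
`s_u` of a configuration `s` and a mode `u`. -/
noncomputable def FMScheduler.kernel (fm : FMScheduler N) :
    Conf Q C M × fm.Mode → Conf Q C M × fm.Mode → ℝ≥0∞ :=
  fun a b =>
    if b.2 = fm.upd a.2 a.1 then N.stepProb a.1 (fm.D a.2 a.1) b.1 else 0

/-- Probability measure of the Markov chain `MC_U` of a finite-memory
scheduler, over trajectories of (configuration, mode) states. -/
noncomputable def FMScheduler.PrMC (fm : FMScheduler N)
    (a : Conf Q C M × fm.Mode) (E : Set (ℕ → Conf Q C M × fm.Mode)) : ℝ≥0∞ :=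
  chainPr fm.kernel a E

/-- Reachability in the Markov chain `MC_U` of a finite-memory scheduler. -/
def FMScheduler.MCReach (fm : FMScheduler N) :
    Conf Q C M × fm.Mode → Conf Q C M × fm.Mode → Prop :=
  Relation.ReflTransGen (fun a b => 0 < fm.kernel a b)

/-- The history (the first `i` configurations) of a trajectory. -/
def histTo (ω : ℕ → Conf Q C M) (i : ℕ) : List (Conf Q C M) :=
  (List.range i).map ω

/-- Almost blind scheduler: there are a scheduler `W` and a blind scheduler
`V` such that from any starting configuration, almost surely the choices of
`U` along the path agree with those of `W` up to some finite time and with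
those of `V` afterwards. -/
def Scheduler.AlmostBlind (U : Scheduler N) : Prop :=
  ∃ W V : Scheduler N, V.Blind ∧ ∀ s : Conf Q C M,
    U.Pr s {ω | ∃ n : ℕ,
      (∀ i ≤ n, U.choose (histTo ω i) (ω i) = W.choose (histTo ω i) (ω i)) ∧
      (∀ i, n < i → U.choose (histTo ω i) (ω i) = V.choose (histTo ω i) (ω i))} = 1

/-! ## LTL-style events on trajectories -/

/-- `□P` -/
def evAlways {α : Type} (P : α → Prop) : Set (ℕ → α) := {ω | ∀ i, P (ω i)}

/-- `◇P` -/
def evEventually {α : Type} (P : α → Prop) : Set (ℕ → α) := {ω | ∃ i, P (ω i)}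

/-- `□◇P` -/
def evInfOften {α : Type} (P : α → Prop) : Set (ℕ → α) :=
  {ω | ∀ n, ∃ i, n ≤ i ∧ P (ω i)}

/-- `◇□P` -/
def evEvAlways {α : Type} (P : α → Prop) : Set (ℕ → α) :=
  {ω | ∃ n, ∀ i, n ≤ i → P (ω i)}

/-- The atomic proposition "the current location belongs to `A`". -/
def inLoc (A : Set Q) : Conf Q C M → Prop := fun s => s.1 ∈ A


section ChainLemmas
variable {S : Type}

theorem mem_chainCyl_cons {s t : S} {l : List S} {ω : ℕ → S} :
    ω ∈ chainCyl s (t :: l) ↔ ω 0 = s ∧ (fun i => ω (i + 1)) ∈ chainCyl t l := by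
  simp only [chainCyl, Set.mem_ofPred_eq]
  refine and_congr_right fun _ => ⟨fun h => ⟨by simpa using h 0 (by simp), fun i hi => ?_⟩, ?_⟩
  · simpa using h (i + 1) (by simpa using hi)
  · rintro ⟨h0, h⟩ (_ | i) hi
    · simpa using h0
    · simpa using h i (by simpa using hi)

theorem mem_chainCyl_nil {s : S} {ω : ℕ → S} : ω ∈ chainCyl s [] ↔ ω 0 = s := by
  simp [chainCyl]

theorem mem_chainCyl_append_singleton {s b : S} {l : List S} {ω : ℕ → S} :
    ω ∈ chainCyl s (l ++ [b]) ↔ ω ∈ chainCyl s l ∧ ω (l.length + 1) = b := by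
  induction l generalizing s ω with
  | nil => simp [mem_chainCyl_cons, mem_chainCyl_nil]
  | cons t l ih => rw [List.cons_append, mem_chainCyl_cons, ih, mem_chainCyl_cons, and_assoc]; rfl

theorem getLastD_of_mem_chainCyl {s : S} {l : List S} {ω : ℕ → S} (h : ω ∈ chainCyl s l) :
    l.getLastD s = ω l.length := by
  rcases List.eq_nil_or_concat l with rfl | ⟨l, b, rfl⟩
  · simpa using (mem_chainCyl_nil.1 h).symm
  · simpa using (mem_chainCyl_append_singleton.1 (by simpa using h)).2.symm

theorem mem_chainCyl_map_range (ω : ℕ → S) (n : ℕ) :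
    ω ∈ chainCyl (ω 0) ((List.range n).map fun i => ω (i + 1)) := by
  refine ⟨rfl, fun i h => ?_⟩
  simp

theorem chainCyl_nonempty (s : S) (l : List S) : (chainCyl s l).Nonempty := by
  induction l generalizing s with
  | nil => exact ⟨fun _ => s, rfl, fun i h => by simp at h⟩
  | cons t l ih =>
    obtain ⟨ω, hω⟩ := ih t
    exact ⟨fun i => Nat.casesOn i s ω, mem_chainCyl_cons.2 ⟨rfl, hω⟩⟩

theorem chainCyl_injective [Nontrivial S] (s : S) : Function.Injective (chainCyl s) := by
  have nil_ne : ∀ (s t : S) (l : List S), chainCyl s [] ≠ chainCyl s (t :: l) := by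
    intro s t l h
    obtain ⟨u, hu⟩ := exists_ne t
    have h1 : (fun i => Nat.casesOn i s fun _ => u : ℕ → S) ∈ chainCyl s (t :: l) :=
      h ▸ mem_chainCyl_nil.2 rfl
    exact hu (mem_chainCyl_cons.1 h1).2.1
  intro l l' h
  induction l generalizing s l' with
  | nil =>
    cases l' with
    | nil => rfl
    | cons t l' => exact absurd h (nil_ne s t l')
  | cons t l ih =>
    cases l' with
    | nil => exact absurd h.symm (nil_ne s t l)
    | cons t' l' =>
      have key : ∀ ω : ℕ → S, ω ∈ chainCyl t l ↔ ω ∈ chainCyl t' l' := by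
        intro ω
        have h1 := Set.ext_iff.1 h (fun i => Nat.casesOn i s ω)
        rw [mem_chainCyl_cons, mem_chainCyl_cons] at h1
        simpa using h1
      obtain ⟨ω, hω⟩ := chainCyl_nonempty t l
      obtain rfl : t = t' := hω.1.symm.trans ((key ω).1 hω).1
      rw [ih t (Set.ext key)]

theorem chainFun_chainCyl_le (k : S → S → ℝ≥0∞) (s : S) (l : List S) :
    chainFun k s (chainCyl s l) ≤ chainPathProb k s l := by
  rw [chainFun, if_neg (chainCyl_nonempty s l).ne_empty]
  exact iInf₂_le (f := fun l' (_ : chainCyl s l = chainCyl s l') => chainPathProb k s l') l rfl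

theorem chainFun_chainCyl [Nontrivial S] (k : S → S → ℝ≥0∞) (s : S) (l : List S) :
    chainFun k s (chainCyl s l) = chainPathProb k s l := by
  refine (chainFun_chainCyl_le k s l).antisymm ?_
  rw [chainFun, if_neg (chainCyl_nonempty s l).ne_empty]
  exact le_iInf₂ fun l' h => by rw [chainCyl_injective s h]

theorem chainFun_eq_top {k : S → S → ℝ≥0∞} {s : S} {A : Set (ℕ → S)} (h : A.Nonempty)
    (hA : ∀ l, A ≠ chainCyl s l) : chainFun k s A = ∞ := by
  simp [chainFun, h.ne_empty, hA]

theorem chainPathProb_append_singleton (k : S → S → ℝ≥0∞) (s b : S) (l : List S) :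
    chainPathProb k s (l ++ [b]) = chainPathProb k s l * k (l.getLastD s) b := by
  induction l generalizing s with
  | nil => simp [chainPathProb]
  | cons t l ih =>
    rw [List.cons_append, chainPathProb, ih, chainPathProb, mul_assoc, List.getLastD_cons]

/-- The outer measure underlying `chainPr`. -/
noncomputable def chainOuter (k : S → S → ℝ≥0∞) (s : S) :
    MeasureTheory.OuterMeasure (ℕ → S) :=
  MeasureTheory.OuterMeasure.ofFunction (chainFun k s) (chainFun_empty k s)

theorem chainPr_eq (k : S → S → ℝ≥0∞) (s : S) (E : Set (ℕ → S)) :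
    chainPr k s E = chainOuter k s (E ∩ {ω | ω 0 = s}) := rfl

theorem chainOuter_chainCyl_le (k : S → S → ℝ≥0∞) (s : S) (l : List S) :
    chainOuter k s (chainCyl s l) ≤ chainPathProb k s l :=
  (MeasureTheory.OuterMeasure.ofFunction_le _).trans (chainFun_chainCyl_le k s l)

/-- If the cylinders of the lists in `A` cover all trajectories from `s`, their probabilities
sum up to at least `1`. -/
theorem one_le_tsum_of_cover {k : S → S → ℝ≥0∞} (hk : ∀ a, ∑' b, k a b = 1) (s : S)
    (A : Set (List S)) (hA : ∀ ω : ℕ → S, ω 0 = s → ∃ l ∈ A, ω ∈ chainCyl s l) :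
    1 ≤ ∑' l, A.indicator (chainPathProb k s) l := by
  by_contra! hlt
  have not_nil : ∀ (s : S) (A : Set (List S)),
      ∑' l, A.indicator (chainPathProb k s) l < 1 → [] ∉ A := by
    intro s A h hn
    refine h.not_ge ?_
    calc (1 : ℝ≥0∞) = A.indicator (chainPathProb k s) [] := by simp [hn, chainPathProb]
      _ ≤ _ := ENNReal.le_tsum _
  have step : ∀ p : {p : S × Set (List S) // ∑' l, p.2.indicator (chainPathProb k p.1) l < 1},
      ∃ t, ∑' l, {u | t :: u ∈ p.1.2}.indicator (chainPathProb k t) l < 1 := by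
    rintro ⟨⟨s, A⟩, h⟩
    by_contra! hge
    refine h.not_ge ?_
    calc (1 : ℝ≥0∞) = ∑' t, k s t * 1 := by simp [hk]
      _ ≤ ∑' t, k s t * ∑' u, {u | t :: u ∈ A}.indicator (chainPathProb k t) u := by
          gcongr with t; exact hge t
      _ = ∑' p : S × List S, A.indicator (chainPathProb k s) (p.1 :: p.2) := by
          rw [ENNReal.tsum_prod (f := fun t u => A.indicator (chainPathProb k s) (t :: u))]
          refine tsum_congr fun t => ?_
          rw [← ENNReal.tsum_mul_left]
          refine tsum_congr fun u => ?_
          by_cases hu : t :: u ∈ A <;> simp [hu, chainPathProb]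
      _ ≤ _ := ENNReal.tsum_comp_le_tsum_of_injective (f := fun p : S × List S => p.1 :: p.2)
          (fun p q h => Prod.ext (List.cons.inj h).1 (List.cons.inj h).2) _
  choose nxt hnxt using step
  let seq : ℕ → {p : S × Set (List S) // ∑' l, p.2.indicator (chainPathProb k p.1) l < 1} :=
    fun n => Nat.rec ⟨(s, A), hlt⟩ (fun _ p => ⟨(nxt p, {u | nxt p :: u ∈ p.1.2}), hnxt p⟩) n
  have key : ∀ (l : List S) (n : ℕ), l ∈ (seq n).1.2 →
      (fun i => (seq (n + i)).1.1) ∉ chainCyl (seq n).1.1 l := by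
    intro l
    induction l with
    | nil => exact fun n h _ => not_nil _ _ (seq n).2 h
    | cons t l ih =>
      intro n h hω
      have h2 := (mem_chainCyl_cons.1 hω).2
      have h3 : nxt (seq n) = t := h2.1
      subst h3
      exact ih (n + 1) h (by simpa only [add_assoc, add_comm 1, add_left_comm] using h2)
  obtain ⟨l, hl, hω⟩ := hA (fun i => (seq (0 + i)).1.1) rfl
  exact key l 0 hl hω

theorem chainPathProb_le_tsum_of_cover {k : S → S → ℝ≥0∞} (hk : ∀ a, ∑' b, k a b = 1) (s : S)
    (l : List S) (A : Set (List S))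
    (hA : ∀ ω ∈ chainCyl s l, ∃ u ∈ A, ω ∈ chainCyl s u) :
    chainPathProb k s l ≤ ∑' u, A.indicator (chainPathProb k s) u := by
  induction l generalizing s A with
  | nil => exact one_le_tsum_of_cover hk s A fun ω h => hA ω (mem_chainCyl_nil.2 h)
  | cons t l ih =>
    by_cases hn : [] ∈ A
    · refine (one_le_tsum_of_cover hk s A fun ω h => ⟨[], hn, mem_chainCyl_nil.2 h⟩).trans' ?_
      have le_one : ∀ (l : List S) (s : S), chainPathProb k s l ≤ 1 := by
        intro l
        induction l with
        | nil => exact fun s => le_rfl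
        | cons t l ih => exact fun s => mul_le_one' (hk s ▸ ENNReal.le_tsum t) (ih t)
      exact le_one _ _
    · have h1 := ih t {u | t :: u ∈ A} fun ω hω => by
        obtain ⟨u, hu, hmem⟩ := hA (fun i => Nat.casesOn i s ω) (mem_chainCyl_cons.2 ⟨rfl, hω⟩)
        cases u with
        | nil => exact absurd hu hn
        | cons t' u =>
          have h2 := (mem_chainCyl_cons.1 hmem).2
          have h3 : t = t' := hω.1.symm.trans h2.1
          subst h3
          exact ⟨u, hu, h2⟩
      calc chainPathProb k s (t :: l)
          ≤ k s t * ∑' u, {u | t :: u ∈ A}.indicator (chainPathProb k t) u := by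
            rw [chainPathProb]; gcongr
        _ = ∑' u, A.indicator (chainPathProb k s) (t :: u) := by
            rw [← ENNReal.tsum_mul_left]
            refine tsum_congr fun u => ?_
            by_cases hu : t :: u ∈ A <;> simp [hu, chainPathProb]
        _ ≤ _ := ENNReal.tsum_comp_le_tsum_of_injective (List.cons_injective) _

theorem chainOuter_chainCyl [Nontrivial S] {k : S → S → ℝ≥0∞} (hk : ∀ a, ∑' b, k a b = 1)
    (s : S) (l : List S) : chainOuter k s (chainCyl s l) = chainPathProb k s l := by
  refine (chainOuter_chainCyl_le k s l).antisymm ?_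
  rw [chainOuter, MeasureTheory.OuterMeasure.ofFunction_apply]
  refine le_iInf₂ fun t ht => ?_
  by_cases htop : ∃ n, chainFun k s (t n) = ∞
  · exact (ENNReal.tsum_eq_top_of_eq_top htop).symm ▸ le_top
  push Not at htop
  refine (chainPathProb_le_tsum_of_cover hk s l {u | ∃ n, t n = chainCyl s u}
    fun ω hω => ?_).trans ?_
  · obtain ⟨n, hn⟩ := Set.mem_iUnion.1 (ht hω)
    by_contra! hno
    refine htop n (chainFun_eq_top ⟨ω, hn⟩ fun u hu => hno u ⟨n, hu⟩ (hu ▸ hn))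
  · calc _ ≤ ∑' u, ∑' n, (if t n = chainCyl s u then chainPathProb k s u else 0) := by
          refine ENNReal.tsum_le_tsum fun u => ?_
          by_cases hu : ∃ n, t n = chainCyl s u
          · obtain ⟨n, hn⟩ := hu
            refine le_trans ?_ (ENNReal.le_tsum n)
            rw [if_pos hn]
            exact Set.indicator_le_self' (fun _ _ => zero_le) u
          · simp [hu]
      _ = ∑' n, ∑' u, (if t n = chainCyl s u then chainPathProb k s u else 0) :=
          ENNReal.tsum_comm
      _ ≤ _ := by
          refine ENNReal.tsum_le_tsum fun n => ?_
          by_cases hn : ∃ u, t n = chainCyl s u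
          · obtain ⟨u, hu⟩ := hn
            rw [hu, chainFun_chainCyl, tsum_eq_single u]
            · simp
            · intro v hv
              exact if_neg fun h => hv (chainCyl_injective s h).symm
          · push Not at hn
            simp [hn]

theorem chainPr_univ [Nontrivial S] {k : S → S → ℝ≥0∞} (hk : ∀ a, ∑' b, k a b = 1) (s : S) :
    chainPr k s Set.univ = 1 := by
  have h : Set.univ ∩ {ω : ℕ → S | ω 0 = s} = chainCyl s [] := by
    ext ω; simp [mem_chainCyl_nil]
  rw [chainPr_eq, h, chainOuter_chainCyl hk, chainPathProb]

/-- Almost surely, a chain only performs steps of positive probability. -/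
theorem chainOuter_impossible_step [Countable S] (k : S → S → ℝ≥0∞) (s : S) :
    chainOuter k s {ω | ω 0 = s ∧ ∃ i, k (ω i) (ω (i + 1)) = 0} = 0 := by
  have hsub : {ω : ℕ → S | ω 0 = s ∧ ∃ i, k (ω i) (ω (i + 1)) = 0} ⊆
      ⋃ l : {l : List S // chainPathProb k s l = 0}, chainCyl s l := by
    rintro ω ⟨rfl, i, hi⟩
    have hmem := mem_chainCyl_map_range ω (i + 1)
    refine Set.mem_iUnion.2 ⟨⟨_, ?_⟩, hmem⟩
    rw [List.range_succ, List.map_append, List.map_singleton, chainPathProb_append_singleton,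
      getLastD_of_mem_chainCyl (mem_chainCyl_map_range ω i)]
    simp [hi]
  refine MeasureTheory.measure_mono_null hsub (MeasureTheory.measure_iUnion_null fun l => ?_)
  exact le_antisymm ((chainOuter_chainCyl_le k s l).trans l.2.le) zero_le

/-- The probability that the chain stays in `G` during `n` steps. -/
noncomputable def stayProb (k : S → S → ℝ≥0∞) (G : Set S) : ℕ → S → ℝ≥0∞
  | 0, _ => 1
  | n + 1, a => ∑' b, k a b * G.indicator (stayProb k G n) b

theorem sum_stayProb_le {k : S → S → ℝ≥0∞} {G : Set S} {F : S → ℝ≥0∞}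
    (hF : ∀ a ∈ G, 1 + ∑' b, k a b * G.indicator F b ≤ F a) (n : ℕ) {a : S} (ha : a ∈ G) :
    ∑ j ∈ Finset.range n, stayProb k G j a ≤ F a := by
  induction n generalizing a with
  | zero => simp
  | succ n ih =>
    refine le_trans ?_ (hF a ha)
    rw [Finset.sum_range_succ', add_comm]
    simp only [stayProb]
    gcongr
    rw [← Summable.tsum_finsetSum fun _ _ => ENNReal.summable]
    refine ENNReal.tsum_le_tsum fun b => ?_
    rw [← Finset.mul_sum]
    gcongr
    by_cases hb : b ∈ G
    · simpa [hb] using ih hb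
    · simp [hb]

/-- Staying forever in `G` has probability zero if there is a finite Lyapunov function decreasing
by one in each step inside `G`. -/
theorem chainOuter_stay_eq_zero [Countable S] {k : S → S → ℝ≥0∞} (hk : ∀ a b, k a b ≠ ∞)
    {G : Set S} {F : S → ℝ≥0∞} (hF : ∀ a ∈ G, 1 + ∑' b, k a b * G.indicator F b ≤ F a)
    (hfin : ∀ a, F a ≠ ∞) (s : S) (n : ℕ) :
    chainOuter k s {ω | ω 0 = s ∧ ∀ i, n ≤ i → ω i ∈ G} = 0 := by
  set E : Set (ℕ → S) := {ω | ∀ i, n ≤ i → ω i ∈ G} with hE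
  have bound : ∀ (N : ℕ) (l : List S), n ≤ l.length →
      chainOuter k s (chainCyl s l ∩ E) ≤ chainPathProb k s l * stayProb k G N (l.getLastD s) := by
    intro N
    induction N with
    | zero =>
      intro l _
      simpa [stayProb] using
        (MeasureTheory.measure_mono Set.inter_subset_left).trans (chainOuter_chainCyl_le k s l)
    | succ N ih =>
      intro l hl
      have hsub : chainCyl s l ∩ E ⊆ ⋃ b : S, ⋃ _ : b ∈ G, chainCyl s (l ++ [b]) ∩ E := by
        rintro ω ⟨h1, h2⟩
        refine Set.mem_iUnion₂.2 ⟨ω (l.length + 1), h2 _ (by omega), ?_, h2⟩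
        exact mem_chainCyl_append_singleton.2 ⟨h1, rfl⟩
      calc _ ≤ ∑' b, chainOuter k s (⋃ _ : b ∈ G, chainCyl s (l ++ [b]) ∩ E) :=
            (MeasureTheory.measure_mono hsub).trans (MeasureTheory.measure_iUnion_le _)
        _ ≤ ∑' b, chainPathProb k s l *
              (k (l.getLastD s) b * G.indicator (stayProb k G N) b) := by
            refine ENNReal.tsum_le_tsum fun b => ?_
            by_cases hb : b ∈ G
            · have := ih (l ++ [b]) (by simp; omega)
              simpa [hb, chainPathProb_append_singleton, mul_assoc] using this
            · simp [hb]
        _ = _ := by rw [ENNReal.tsum_mul_left]; rfl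
  have path_ne_top : ∀ (l : List S) (s : S), chainPathProb k s l ≠ ∞ := by
    intro l
    induction l with
    | nil => simp [chainPathProb]
    | cons t l ih => exact fun s => ENNReal.mul_ne_top (hk s t) (ih t)
  have hsub : {ω : ℕ → S | ω 0 = s ∧ ∀ i, n ≤ i → ω i ∈ G} ⊆
      ⋃ l : {l : List S // n ≤ l.length}, chainCyl s l ∩ E := by
    rintro ω ⟨rfl, h⟩
    exact Set.mem_iUnion.2 ⟨⟨_, by simp⟩, mem_chainCyl_map_range ω n, h⟩
  refine MeasureTheory.measure_mono_null hsub (MeasureTheory.measure_iUnion_null ?_)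
  rintro ⟨l, hl⟩
  by_cases hlast : l.getLastD s ∈ G
  · have hsum : ∑' j, stayProb k G j (l.getLastD s) ≠ ∞ :=
      ne_top_of_le_ne_top (hfin _)
        (ENNReal.tsum_le_of_sum_range_le fun N => sum_stayProb_le hF N hlast)
    have hlim := ENNReal.Tendsto.const_mul (a := chainPathProb k s l)
      (ENNReal.tendsto_atTop_zero_of_tsum_ne_top hsum) (Or.inr (path_ne_top l s))
    rw [mul_zero] at hlim
    exact le_antisymm (ge_of_tendsto' hlim fun N => bound N l hl) zero_le
  · convert MeasureTheory.measure_empty (μ := chainOuter k s)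
    refine Set.eq_empty_of_forall_notMem fun ω hω => hlast ?_
    rw [getLastD_of_mem_chainCyl hω.1]
    exact hω.2 _ hl

end ChainLemmas
section Loss

theorem countEmb_eq_count (v w : List M) : countEmb v w = v.sublists'.count w := by
  induction v generalizing w with
  | nil => cases w <;> simp [countEmb]
  | cons a v ih =>
    have cons_count : ∀ (w : List M) (L : List (List M)), (L.map (List.cons a)).count w =
        match w with
        | [] => 0
        | b :: w' => if a = b then L.count w' else 0 := by
      intro w L
      cases w with
      | nil => exact List.count_eq_zero.2 (by simp)
      | cons b w' =>
        by_cases hab : a = b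
        · subst hab
          simp [List.count_map_of_injective L _ (List.cons_injective (a := a)) w']
        · simp only [hab, if_false]
          exact List.count_eq_zero.2 (by simp [hab])
    rw [List.sublists'_cons, List.count_append, cons_count]
    cases w with
    | nil => rw [← ih]; cases v <;> simp [countEmb]
    | cons b w => rw [countEmb, ih, ih, add_comm]

/-- The possible channel contents after message losses. -/
def lossSupp (v : Chans C M) : Finset (Chans C M) :=
  Fintype.piFinset fun c => (v c).sublists'.toFinset

theorem mem_lossSupp {v w : Chans C M} : w ∈ lossSupp v ↔ ∀ c, (w c).Sublist (v c) := by
  simp [lossSupp]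

/-- The real number underlying `plost`. -/
noncomputable def plostReal (τ : ℝ) (v w : Chans C M) : ℝ :=
  τ ^ (chansSize v - chansSize w) * (1 - τ) ^ chansSize w * (∏ c, countEmb (v c) (w c) : ℕ)

theorem plost_eq_ofReal (τ : ℝ) (v w : Chans C M) :
    plost τ v w = ENNReal.ofReal (plostReal τ v w) := rfl

theorem plostReal_nonneg {τ : ℝ} (h0 : 0 < τ) (h1 : τ < 1) (v w : Chans C M) :
    0 ≤ plostReal τ v w := by
  have : 0 < 1 - τ := by linarith
  unfold plostReal
  positivity

theorem plostReal_pos {τ : ℝ} (h0 : 0 < τ) (h1 : τ < 1) {v w : Chans C M} :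
    0 < plostReal τ v w ↔ w ∈ lossSupp v := by
  have h : 0 < 1 - τ := by linarith
  have h2 : 0 < τ ^ (chansSize v - chansSize w) * (1 - τ) ^ chansSize w := by positivity
  rw [plostReal, mul_pos_iff_of_pos_left h2, Nat.cast_pos, pos_iff_ne_zero, Finset.prod_ne_zero_iff,
    mem_lossSupp]
  simp [countEmb_eq_count, List.count_eq_zero]

theorem plost_pos {N : NPLCS Q C M} {v w : Chans C M} :
    0 < plost N.τ v w ↔ ∀ c, (w c).Sublist (v c) := by
  rw [plost_eq_ofReal, ENNReal.ofReal_pos, plostReal_pos N.τ_pos N.τ_lt_one, mem_lossSupp]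

theorem plostReal_eq_prod (τ : ℝ) {v w : Chans C M} (h : w ∈ lossSupp v) :
    plostReal τ v w = ∏ c, (τ ^ ((v c).length - (w c).length) * (1 - τ) ^ (w c).length *
      ((v c).sublists'.count (w c) : ℕ)) := by
  rw [mem_lossSupp] at h
  rw [Finset.prod_mul_distrib, Finset.prod_mul_distrib, Finset.prod_pow_eq_pow_sum,
    Finset.prod_pow_eq_pow_sum, Finset.sum_tsub_distrib _ fun c _ => (h c).length_le, plostReal]
  simp [chansSize, countEmb_eq_count]

theorem sum_sublists'_pow (τ z : ℝ) (v : List M) :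
    (v.sublists'.map fun w => τ ^ (v.length - w.length) * (1 - τ) ^ w.length * z ^ w.length).sum =
      (τ + (1 - τ) * z) ^ v.length := by
  induction v with
  | nil => simp
  | cons a v ih =>
    have h1 : v.sublists'.map (fun w => τ ^ ((a :: v).length - w.length) * (1 - τ) ^ w.length *
        z ^ w.length) = v.sublists'.map fun w => τ * (τ ^ (v.length - w.length) *
          (1 - τ) ^ w.length * z ^ w.length) := by
      refine List.map_congr_left fun w hw => ?_
      have := (List.mem_sublists'.1 hw).length_le
      rw [List.length_cons, Nat.sub_add_comm this]
      ring
    have h2 : (fun w : List M => τ ^ ((a :: v).length - w.length) * (1 - τ) ^ w.length *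
        z ^ w.length) ∘ List.cons a = fun w => ((1 - τ) * z) * (τ ^ (v.length - w.length) *
          (1 - τ) ^ w.length * z ^ w.length) := by
      funext w
      simp only [Function.comp, List.length_cons, Nat.add_sub_add_right]
      ring
    rw [List.sublists'_cons, List.map_append, List.sum_append, List.map_map, h1, h2,
      List.sum_map_mul_left, List.sum_map_mul_left, ih, List.length_cons]
    ring

/-- The generating function of the number of messages that survive. -/
theorem sum_plostReal_mul_pow (τ z : ℝ) (v : Chans C M) :
    ∑ w ∈ lossSupp v, plostReal τ v w * z ^ chansSize w = (τ + (1 - τ) * z) ^ chansSize v := by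
  have h1 : ∀ w ∈ lossSupp v, plostReal τ v w * z ^ chansSize w =
      ∏ c, ((v c).sublists'.count (w c) • (τ ^ ((v c).length - (w c).length) *
        (1 - τ) ^ (w c).length * z ^ (w c).length)) := by
    intro w hw
    rw [plostReal_eq_prod τ hw, chansSize, ← Finset.prod_pow_eq_pow_sum, ← Finset.prod_mul_distrib]
    refine Finset.prod_congr rfl fun c _ => ?_
    rw [nsmul_eq_mul]
    ring
  rw [Finset.sum_congr rfl h1, lossSupp, ← Finset.prod_univ_sum (fun c => (v c).sublists'.toFinset)
    fun c l => (v c).sublists'.count l • (τ ^ ((v c).length - l.length) *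
        (1 - τ) ^ l.length * z ^ l.length), chansSize, ← Finset.prod_pow_eq_pow_sum]
  refine Finset.prod_congr rfl fun c _ => ?_
  rw [← sum_sublists'_pow, Finset.sum_list_map_count]
  congr!

theorem sum_plostReal (τ : ℝ) (v : Chans C M) : ∑ w ∈ lossSupp v, plostReal τ v w = 1 := by
  simpa using sum_plostReal_mul_pow τ 1 v

theorem tsum_stepProb_mul (s : Conf Q C M) {δ : LcsRule Q C M} (hδ : δ ∈ N.L.rules)
    (hen : δ.EnabledIn s) (g : Conf Q C M → ℝ≥0∞) :
    ∑' t, N.stepProb s δ t * g t =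
      ∑ w ∈ lossSupp (applyOp δ.op s.2), plost N.τ (applyOp δ.op s.2) w * g (δ.dst, w) := by
  rw [ENNReal.tsum_prod', tsum_eq_single δ.dst, tsum_eq_sum]
  · exact Finset.sum_congr rfl fun w _ => by simp [NPLCS.stepProb, hδ, hen]
  · intro w hw
    have : ¬ 0 < plost N.τ (applyOp δ.op s.2) w := by rwa [plost_pos, ← mem_lossSupp]
    simp [NPLCS.stepProb, nonpos_iff_eq_zero.1 (not_lt.1 this)]
  · intro x hx
    simp [NPLCS.stepProb, hx]

theorem stepProb_pos {s t : Conf Q C M} {δ : LcsRule Q C M} :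
    0 < N.stepProb s δ t ↔ N.L.StepVia s δ t := by
  by_cases h : δ ∈ N.L.rules ∧ δ.EnabledIn s ∧ t.1 = δ.dst
  · rw [NPLCS.stepProb, if_pos h, plost_pos]
    exact ⟨fun h2 => ⟨h.1, h.2.1, h.2.2, h2⟩, fun h2 => h2.2.2.2⟩
  · rw [NPLCS.stepProb, if_neg h]
    exact ⟨fun h2 => absurd h2 (lt_irrefl 0), fun h2 => absurd ⟨h2.1, h2.2.1, h2.2.2.1⟩ h⟩

theorem Scheduler.tsum_kernel_mul (U : Scheduler N) (a : List (Conf Q C M) × Conf Q C M)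
    (g : List (Conf Q C M) × Conf Q C M → ℝ≥0∞) :
    ∑' b, U.kernel a b * g b =
      ∑' t, N.stepProb a.2 (U.choose a.1 a.2) t * g (a.1 ++ [a.2], t) := by
  rw [ENNReal.tsum_prod', tsum_eq_single (a.1 ++ [a.2])]
  · simp [Scheduler.kernel]
  · intro h hh
    simp [Scheduler.kernel, hh]

theorem Scheduler.tsum_kernel (U : Scheduler N) (a : List (Conf Q C M) × Conf Q C M) :
    ∑' b, U.kernel a b = 1 := by
  have h := U.tsum_kernel_mul a fun _ => 1
  rw [tsum_stepProb_mul _ (U.choose_mem _ _) (U.choose_enabled _ _)] at h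
  simp only [mul_one] at h
  rw [h]
  simp only [plost_eq_ofReal]
  rw [← ENNReal.ofReal_sum_of_nonneg fun w _ => plostReal_nonneg N.τ_pos N.τ_lt_one _ _,
    sum_plostReal, ENNReal.ofReal_one]

theorem Scheduler.kernel_ne_top (U : Scheduler N) (a b : List (Conf Q C M) × Conf Q C M) :
    U.kernel a b ≠ ∞ :=
  ne_top_of_le_ne_top ENNReal.one_ne_top (U.tsum_kernel a ▸ ENNReal.le_tsum b)

theorem Scheduler.kernel_pos {U : Scheduler N} {a b : List (Conf Q C M) × Conf Q C M} :
    0 < U.kernel a b ↔ b.1 = a.1 ++ [a.2] ∧ N.L.StepVia a.2 (U.choose a.1 a.2) b.2 := by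
  by_cases h : b.1 = a.1 ++ [a.2] <;> simp [Scheduler.kernel, h, stepProb_pos]

theorem Scheduler.kernel_ne_zero {U : Scheduler N} {a b : List (Conf Q C M) × Conf Q C M} :
    U.kernel a b ≠ 0 ↔ b.1 = a.1 ++ [a.2] ∧ N.L.StepVia a.2 (U.choose a.1 a.2) b.2 := by
  rw [← pos_iff_ne_zero, Scheduler.kernel_pos]

end Loss

section Lyapunov

theorem chansSize_applyOp_le (op : LcsOp C M) (w : Chans C M) :
    chansSize (applyOp op w) ≤ chansSize w + 1 := by
  have key : ∀ (c : C) (l : List M), l.length ≤ (w c).length + 1 →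
      chansSize (Function.update w c l) ≤ chansSize w + 1 := by
    intro c l hl
    unfold chansSize
    rw [← Finset.add_sum_erase _ _ (Finset.mem_univ c),
      ← Finset.add_sum_erase (Finset.univ) (fun c => (w c).length) (Finset.mem_univ c),
      Finset.sum_congr rfl fun d hd => by rw [Function.update_of_ne (Finset.ne_of_mem_erase hd)],
      Function.update_self]
    omega
  cases op with
  | send c m => exact key c _ (by simp)
  | recv c m => exact key c _ (by simp; omega)
  | internal => exact Nat.le_succ _

theorem exists_pow_bound {τ : ℝ} (h0 : 0 < τ) (h1 : τ < 1) :
    ∃ b : ℝ, 0 ≤ b ∧ ∀ n : ℕ, 1 + (2 - τ) ^ (n + 1) ≤ b * τ ^ (n + 1) + 2 ^ n := by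
  have hlim : Filter.Tendsto (fun n : ℕ => (1 / 2 : ℝ) ^ n + (2 - τ) * ((2 - τ) / 2) ^ n)
      Filter.atTop (nhds (0 + (2 - τ) * 0)) :=
    (tendsto_pow_atTop_nhds_zero_of_lt_one (by norm_num) (by norm_num)).add
      ((tendsto_pow_atTop_nhds_zero_of_lt_one (by linarith) (by linarith)).const_mul _)
  obtain ⟨n₀, hn₀⟩ := Filter.eventually_atTop.1
    (hlim.eventually_lt_const (u := 1) (by norm_num))
  refine ⟨(1 + 2 ^ (n₀ + 1)) / τ ^ (n₀ + 1), by positivity, fun n => ?_⟩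
  have h2 : (0 : ℝ) < 2 ^ n := by positivity
  rcases le_total n₀ n with hn | hn
  · have h3 : ((1 / 2 : ℝ) ^ n + (2 - τ) * ((2 - τ) / 2) ^ n) * 2 ^ n ≤ 1 * 2 ^ n := by
      gcongr; exact (hn₀ n hn).le
    have h4 : ((1 / 2 : ℝ) ^ n + (2 - τ) * ((2 - τ) / 2) ^ n) * 2 ^ n =
        1 + (2 - τ) ^ (n + 1) := by
      rw [div_pow, div_pow, one_pow, pow_succ]; field_simp
    have h5 : 0 ≤ (1 + 2 ^ (n₀ + 1)) / τ ^ (n₀ + 1) * τ ^ (n + 1) := by positivity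
    linarith
  · have h3 : (2 - τ) ^ (n + 1) ≤ (2 : ℝ) ^ (n₀ + 1) :=
      (pow_le_pow_left₀ (by linarith) (by linarith) _).trans
        (pow_le_pow_right₀ (by norm_num) (by omega))
    have h4 : τ ^ (n₀ + 1) ≤ τ ^ (n + 1) := pow_le_pow_of_le_one h0.le h1.le (by omega)
    have h5 : (1 + 2 ^ (n₀ + 1)) ≤ (1 + 2 ^ (n₀ + 1)) / τ ^ (n₀ + 1) * τ ^ (n + 1) := by
      rw [div_mul_eq_mul_div, le_div_iff₀ (by positivity)]
      gcongr
    linarith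

/-- Locations of `B` outside `Safe(B)` can be ranked such that steps from the empty channel contents
decrease the rank. -/
theorem LCS.exists_rank [Finite Q] (L : LCS Q C M) (B : Set Q) :
    ∃ (r : Q → ℕ) (K : ℕ), (∀ x, r x ≤ K) ∧
      ∀ x ∈ B \ L.Safe B, ∀ t, L.Step (x, eps C M) t → t.1 ∈ B \ L.Safe B → r t.1 < r x := by
  let R : Q → Q → Prop := fun y x =>
    x ∈ B \ L.Safe B ∧ y ∈ B \ L.Safe B ∧ ∃ t, L.Step (x, eps C M) t ∧ t.1 = y
  have hsucc : ∀ x, ¬ Acc R x → ∃ y, R y x ∧ ¬ Acc R y := by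
    intro x hx
    by_contra! h
    exact hx ⟨x, h⟩
  have hsafe : L.IsSafeFor B {x | ¬ Acc R x} := by
    constructor
    · intro x hx
      obtain ⟨y, hy, -⟩ := hsucc x hx
      exact hy.1.1
    · intro x hx
      obtain ⟨y, ⟨-, -, t, ht, rfl⟩, hacc⟩ := hsucc x hx
      exact ⟨t, ht, hacc⟩
  have hacc : ∀ x, Acc R x := by
    intro x
    by_contra hx
    obtain ⟨y, hy, -⟩ := hsucc x hx
    exact hy.1.2 (Set.mem_sUnion.2 ⟨_, hsafe, hx⟩)
  have hwf : WellFounded (Relation.TransGen R) := (WellFounded.intro hacc).transGen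
  refine ⟨fun x => {y | Relation.TransGen R y x}.ncard, Nat.card Q,
    fun x => Set.ncard_le_card _, fun x hx t hstep ht => ?_⟩
  have hR : Relation.TransGen R t.1 x := Relation.TransGen.single ⟨hx, ht, t, hstep, rfl⟩
  refine Set.ncard_lt_ncard ⟨fun y hy => hy.trans hR, fun h => ?_⟩ (Set.toFinite _)
  exact hwf.irrefl.irrefl _ (h hR)

/-- A Lyapunov function for staying in `B` without reaching `Safe(B)`. -/
theorem NPLCS.exists_lyapunov [Finite Q] (N : NPLCS Q C M) (B : Set Q) :
    ∃ f : Conf Q C M → ℝ, (∀ s, 0 ≤ f s) ∧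
      ∀ s δ, s.1 ∈ B \ N.L.Safe B → δ ∈ N.L.rules → δ.EnabledIn s →
        ∑ w ∈ lossSupp (applyOp δ.op s.2), plostReal N.τ (applyOp δ.op s.2) w *
          (if δ.dst ∈ B \ N.L.Safe B then f (δ.dst, w) else 0) ≤ f s - 1 := by
  obtain ⟨r, K, hrK, hr⟩ := N.L.exists_rank B
  obtain ⟨b, hb, hpow⟩ := exists_pow_bound N.τ_pos N.τ_lt_one
  have h0 := N.τ_pos
  have h1 := N.τ_lt_one
  obtain ⟨τ, hτ⟩ : ∃ τ, τ = N.τ := ⟨_, rfl⟩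
  rw [← hτ] at hpow h0 h1 ⊢
  obtain ⟨θ, hθ⟩ : ∃ θ, θ = τ / 2 := ⟨_, rfl⟩
  have hθ0 : 0 < θ := by linarith
  have hθ1 : θ < 1 := by linarith
  have hθpow : ∀ i, θ ^ i ≤ 1 := fun i => pow_le_one₀ hθ0.le hθ1.le
  obtain ⟨W, hW⟩ : ∃ W, W = (b + 3) / θ ^ (K + 1) := ⟨_, rfl⟩
  have hW0 : 0 ≤ W := by rw [hW]; positivity
  have hWθ : ∀ i ≤ K + 1, b + 3 ≤ W * θ ^ i := by
    intro i hi
    rw [hW, div_mul_eq_mul_div, le_div_iff₀ (by positivity)]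
    gcongr ?_ * ?_
    exact pow_le_pow_of_le_one hθ0.le hθ1.le hi
  have hWle : ∀ i, W * θ ^ i ≤ W := fun i => mul_le_of_le_one_right hW0 (hθpow i)
  let f : Conf Q C M → ℝ := fun s =>
    if chansSize s.2 = 0 then W * (1 - θ ^ (r s.1 + 1)) else W + b + 2 ^ chansSize s.2
  have bound : ∀ (v : Chans C M) (g : Chans C M → ℝ) (c : ℝ),
      (∀ w, g w ≤ W + b + 2 ^ chansSize w - c * 0 ^ chansSize w) →
      ∑ w ∈ lossSupp v, plostReal τ v w * g w ≤
        W + b + (2 - τ) ^ chansSize v - c * τ ^ chansSize v := by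
    intro v g c hg
    calc _ ≤ ∑ w ∈ lossSupp v, plostReal τ v w *
            (W + b + 2 ^ chansSize w - c * 0 ^ chansSize w) := by
          refine Finset.sum_le_sum fun w _ => ?_
          exact mul_le_mul_of_nonneg_left (hg w) (plostReal_nonneg h0 h1 _ _)
      _ = (W + b) * ∑ w ∈ lossSupp v, plostReal τ v w +
            ∑ w ∈ lossSupp v, plostReal τ v w * 2 ^ chansSize w -
            c * ∑ w ∈ lossSupp v, plostReal τ v w * 0 ^ chansSize w := by
          rw [Finset.mul_sum, Finset.mul_sum, ← Finset.sum_add_distrib, ← Finset.sum_sub_distrib]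
          exact Finset.sum_congr rfl fun w _ => by ring
      _ = _ := by
          rw [sum_plostReal, sum_plostReal_mul_pow, sum_plostReal_mul_pow]
          ring
  refine ⟨f, fun s => ?_, fun s δ hs hδ hen => ?_⟩
  · simp only [f]
    split_ifs
    · exact mul_nonneg hW0 (by linarith [hθpow (r s.1 + 1)])
    · positivity
  have hsize := chansSize_applyOp_le δ.op s.2
  by_cases hzero : chansSize s.2 = 0
  · have hs2 : s.2 = eps C M := by
      funext c
      exact List.length_eq_zero_iff.1 ((Finset.sum_eq_zero_iff.1 hzero) c (Finset.mem_univ c))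
    have hrank : δ.dst ∈ B \ N.L.Safe B → r δ.dst + 1 ≤ r s.1 := by
      intro hd
      refine hr s.1 hs (δ.dst, applyOp δ.op s.2) ?_ hd
      rw [← hs2]
      exact ⟨δ, hδ, hen, rfl, fun c => List.Sublist.refl _⟩
    refine (bound _ _ (b + W * θ ^ r s.1) fun w => ?_).trans ?_
    · rcases Nat.eq_zero_or_pos (chansSize w) with hw | hw
      · rw [hw]
        split_ifs with hd
        · simp only [f, hw, if_true]
          have : W * θ ^ r s.1 ≤ W * θ ^ (r δ.dst + 1) := by
            gcongr ?_ * ?_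
            exact pow_le_pow_of_le_one hθ0.le hθ1.le (hrank hd)
          linarith
        · linarith [hWle (r s.1)]
      · rw [zero_pow hw.ne', mul_zero, sub_zero]
        split_ifs with hd
        · simp only [f, hw.ne', if_false, le_refl]
        · positivity
    · simp only [f, hzero, if_true]
      rw [hzero, zero_add] at hsize
      have hv : τ ≤ τ ^ chansSize (applyOp δ.op s.2) := by
        simpa using pow_le_pow_of_le_one h0.le h1.le hsize
      have hv2 : (2 - τ) ^ chansSize (applyOp δ.op s.2) ≤ 2 - τ := by
        simpa using pow_le_pow_right₀ (a := 2 - τ) (by linarith) hsize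
      have h4 : (b + W * θ ^ r s.1) * τ ≤
          (b + W * θ ^ r s.1) * τ ^ chansSize (applyOp δ.op s.2) := by gcongr
      have h5 : W * θ ^ r s.1 * τ = 2 * (W * θ ^ (r s.1 + 1)) := by rw [hθ]; ring
      have h6 := hWθ (r s.1 + 1) (by have := hrK s.1; omega)
      have h7 : 0 ≤ b * τ := by positivity
      linarith
  · refine (bound _ _ b fun w => ?_).trans ?_
    · rcases Nat.eq_zero_or_pos (chansSize w) with hw | hw
      · rw [hw]
        split_ifs with hd
        · simp only [f, hw, if_true]
          have : 0 ≤ W * θ ^ (r δ.dst + 1) := by positivity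
          linarith
        · linarith
      · rw [zero_pow hw.ne', mul_zero, sub_zero]
        split_ifs with hd
        · simp only [f, hw.ne', if_false, le_refl]
        · positivity
    · simp only [f, hzero, if_false]
      have hv : b * τ ^ (chansSize s.2 + 1) ≤ b * τ ^ chansSize (applyOp δ.op s.2) :=
        mul_le_mul_of_nonneg_left (pow_le_pow_of_le_one h0.le h1.le hsize) hb
      have hv2 : (2 - τ) ^ chansSize (applyOp δ.op s.2) ≤ (2 - τ) ^ (chansSize s.2 + 1) :=
        pow_le_pow_right₀ (by linarith) hsize
      have := hpow (chansSize s.2)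
      linarith

end Lyapunov
section Main

theorem LCS.isSafeFor_safe (L : LCS Q C M) (A : Set Q) : L.IsSafeFor A (L.Safe A) := by
  refine ⟨Set.sUnion_subset fun X hX => hX.1, fun x hx => ?_⟩
  obtain ⟨X, hX, hxX⟩ := Set.mem_sUnion.1 hx
  obtain ⟨t, ht, htX⟩ := hX.2 x hxX
  exact ⟨t, ht, Set.mem_sUnion.2 ⟨X, hX, htX⟩⟩

/-- If `Safe(B)` is unreachable then `◇□B` has probability zero. -/
theorem Scheduler.pr_evEvAlways_eq_zero [Finite Q] [Finite M] (U : Scheduler N) (s : Conf Q C M)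
    (B : Set Q) (h : ∀ t, N.L.Reach s t → t.1 ∉ N.L.Safe B) :
    U.Pr s (evEvAlways (inLoc B)) = 0 := by
  obtain ⟨f, hf0, hf⟩ := N.exists_lyapunov B
  let G : Set (List (Conf Q C M) × Conf Q C M) := {a | a.2.1 ∈ B \ N.L.Safe B}
  have hF : ∀ a ∈ G, 1 + ∑' b, U.kernel a b * G.indicator (fun b => ENNReal.ofReal (f b.2)) b ≤
      ENNReal.ofReal (f a.2) := by
    intro a ha
    have hen := U.choose_enabled a.1 a.2
    have hrule := U.choose_mem a.1 a.2
    have hpn := plostReal_nonneg (C := C) (M := M) N.τ_pos N.τ_lt_one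
    have hg : ∀ w, 0 ≤ if (U.choose a.1 a.2).dst ∈ B \ N.L.Safe B then
        f ((U.choose a.1 a.2).dst, w) else 0 := by
      intro w
      split_ifs
      exacts [hf0 _, le_rfl]
    have hle := hf a.2 _ ha hrule hen
    rw [U.tsum_kernel_mul, tsum_stepProb_mul a.2 hrule hen
      fun t => G.indicator (fun b => ENNReal.ofReal (f b.2)) (a.1 ++ [a.2], t)]
    have hterm : ∀ w, plost N.τ (applyOp (U.choose a.1 a.2).op a.2.2) w *
        G.indicator (fun b => ENNReal.ofReal (f b.2))
          (a.1 ++ [a.2], ((U.choose a.1 a.2).dst, w)) =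
        ENNReal.ofReal (plostReal N.τ (applyOp (U.choose a.1 a.2).op a.2.2) w *
          if (U.choose a.1 a.2).dst ∈ B \ N.L.Safe B then
            f ((U.choose a.1 a.2).dst, w) else 0) := by
      intro w
      rw [ENNReal.ofReal_mul (hpn _ _), plost_eq_ofReal]
      by_cases hd : (U.choose a.1 a.2).dst ∈ B \ N.L.Safe B
      · rw [if_pos hd, Set.indicator_of_mem (show (a.1 ++ [a.2], _, w) ∈ G from hd)]
      · rw [if_neg hd, Set.indicator_of_notMem (show (a.1 ++ [a.2], _, w) ∉ G from hd), ENNReal.ofReal_zero]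
    rw [Finset.sum_congr rfl fun w _ => hterm w,
      ← ENNReal.ofReal_sum_of_nonneg fun w _ => mul_nonneg (hpn _ _) (hg w),
      ← ENNReal.ofReal_one, ← ENNReal.ofReal_add zero_le_one
        (Finset.sum_nonneg fun w _ => mul_nonneg (hpn _ _) (hg w))]
    exact ENNReal.ofReal_le_ofReal (by linarith)
  have hnull := MeasureTheory.measure_union_null
    (chainOuter_impossible_step U.kernel (([], s) : List (Conf Q C M) × Conf Q C M))
    (MeasureTheory.measure_iUnion_null fun n =>
      chainOuter_stay_eq_zero U.kernel_ne_top hF (fun _ => ENNReal.ofReal_ne_top) ([], s) n)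
  refine MeasureTheory.measure_mono_null ?_ hnull
  rintro ω ⟨⟨n, hn⟩, hω⟩
  by_cases hbad : ∃ i, U.kernel (ω i) (ω (i + 1)) = 0
  · exact Or.inl ⟨hω, hbad⟩
  · push Not at hbad
    have hreach : ∀ i, N.L.Reach s (ω i).2 := by
      intro i
      induction i with
      | zero => rw [show ω 0 = ([], s) from hω]; exact Relation.ReflTransGen.refl
      | succ i ih => exact ih.tail ⟨_, (Scheduler.kernel_ne_zero.1 (hbad i)).2⟩
    exact Or.inr (Set.mem_iUnion.2 ⟨n, hω, fun i hi => ⟨hn i hi, h _ (hreach i)⟩⟩)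

/-- A reachability path, as a sequence of configurations and rules. -/
theorem LCS.Reach.exists_path {L : LCS Q C M} {s t : Conf Q C M} (h : L.Reach s t) :
    ∃ (n : ℕ) (c : ℕ → Conf Q C M) (δ : ℕ → LcsRule Q C M), c 0 = s ∧ c n = t ∧
      ∀ i < n, L.StepVia (c i) (δ i) (c (i + 1)) := by
  induction h using Relation.ReflTransGen.head_induction_on with
  | refl => exact ⟨0, fun _ => t, fun _ => ⟨t.1, .internal, t.1⟩, rfl, rfl, by simp⟩
  | @head x _ hstep _ ih =>
    obtain ⟨n, c, δ, h0, hn, hsteps⟩ := ih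
    obtain ⟨δ₀, hδ₀⟩ := hstep
    refine ⟨n + 1, fun i => Nat.casesOn i x c, fun i => Nat.casesOn i δ₀ δ, rfl, hn, ?_⟩
    rintro (_ | i) hi
    · simpa [h0] using hδ₀
    · exact hsteps i (by omega)

/-- There is a choice of non-receive rules under which no location of `Safe(B)` is left to a
location outside `Safe(B)`. -/
theorem LCS.exists_safe_rule (L : LCS Q C M) (B : Set Q) :
    ∃ v : Q → LcsRule Q C M, (∀ x, v x ∈ L.rules) ∧ (∀ s : Conf Q C M, (v s.1).EnabledIn s) ∧
      ∀ x ∈ L.Safe B, (v x).dst ∈ L.Safe B := by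
  have h : ∀ x, ∃ δ ∈ L.rules, δ.src = x ∧ ¬ δ.op.IsRecv ∧
      (x ∈ L.Safe B → δ.dst ∈ L.Safe B) := by
    intro x
    by_cases hx : x ∈ L.Safe B
    · obtain ⟨t, ⟨δ, hδ, hen, hdst, -⟩, ht⟩ := (L.isSafeFor_safe B).2 x hx
      refine ⟨δ, hδ, hen.1, fun hrecv => ?_, fun _ => hdst ▸ ht⟩
      have hop := hen.2
      match hδop : δ.op with
      | .recv c m => rw [hδop] at hop; obtain ⟨w, hw⟩ := hop; simp [eps] at hw
      | .send c m => rw [hδop] at hrecv; exact hrecv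
      | .internal => rw [hδop] at hrecv; exact hrecv
    · obtain ⟨δ, hδ, hsrc, hrecv⟩ := L.noDeadlock x
      exact ⟨δ, hδ, hsrc, hrecv, fun h => absurd h hx⟩
  choose v hv hsrc hrecv hsafe using h
  refine ⟨v, hv, fun s => ⟨hsrc _, ?_⟩, hsafe⟩
  have hr := hrecv s.1
  match hop : (v s.1).op with
  | .recv c m => rw [hop] at hr; exact absurd trivial hr
  | .send c m => trivial
  | .internal => trivial

/-- If `Safe(B)` is reachable, then some almost blind, finite-memory scheduler stays in `B`
eventually forever with positive probability: it tries to follow a path to `Safe(B)` and then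
blindly stays there. -/
theorem NPLCS.exists_almostBlind_finiteMemory [Finite M] [Finite Q] (N : NPLCS Q C M)
    (B : Set Q) {s t : Conf Q C M} (hreach : N.L.Reach s t) (ht : t.1 ∈ N.L.Safe B) :
    ∃ U : Scheduler N, U.AlmostBlind ∧ U.FiniteMemory ∧ 0 < U.Pr s (evEvAlways (inLoc B)) := by
  obtain ⟨n, c, δ, rfl, rfl, hpath⟩ := hreach.exists_path
  obtain ⟨v, hv, hven, hvsafe⟩ := N.L.exists_safe_rule B
  let D : ℕ → Conf Q C M → LcsRule Q C M := fun i x => if i < n ∧ x = c i then δ i else v x.1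
  have hDmem : ∀ i x, D i x ∈ N.L.rules := by
    intro i x
    by_cases h : i < n ∧ x = c i
    · simpa only [D, if_pos h] using (hpath i h.1).1
    · simpa only [D, if_neg h] using hv _
  have hDen : ∀ i x, (D i x).EnabledIn x := by
    intro i x
    by_cases h : i < n ∧ x = c i
    · simp only [D, if_pos h]
      exact h.2 ▸ (hpath i h.1).2.1
    · simpa only [D, if_neg h] using hven _
  have hDlarge : ∀ i x, n ≤ i → D i x = v x.1 := fun i x hi => if_neg fun h => by omega
  let U : Scheduler N := ⟨fun h x => D h.length x, fun _ _ => hDmem _ _, fun _ _ => hDen _ _⟩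
  let V : Scheduler N := ⟨fun _ x => v x.1, fun _ _ => hv _, fun _ x => hven x⟩
  have : Nonempty (Conf Q C M) := ⟨c 0⟩
  refine ⟨U, ⟨U, V, fun h h' x x' _ hx => congrArg v hx, fun x => ?_⟩, ?_, ?_⟩
  · refine (congrArg (chainPr U.kernel ([], x)) (Set.eq_univ_of_forall fun ω => ?_)).trans
      (chainPr_univ U.tsum_kernel _)
    refine ⟨n, fun i _ => rfl, fun i hi => ?_⟩
    exact hDlarge _ _ (by simpa [histTo] using hi.le)
  · let fm : FMScheduler N :=
      { Mode := Fin (n + 1)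
        modeFin := inferInstance
        init := 0
        D := fun u x => D u x
        upd := fun u _ => ⟨min (u + 1) n, by omega⟩
        D_mem := fun _ _ => hDmem _ _
        D_enabled := fun _ _ => hDen _ _ }
    have hfold : ∀ h : List (Conf Q C M),
        ((h.foldl fm.upd fm.init : Fin (n + 1)) : ℕ) = min h.length n := by
      intro h
      induction h using List.reverseRecOn with
      | nil => simp [fm]
      | append_singleton h x ih =>
        rw [List.foldl_append, List.foldl_cons, List.foldl_nil, List.length_append,
          List.length_singleton]
        change min (((h.foldl fm.upd fm.init : Fin (n + 1)) : ℕ) + 1) n = _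
        rw [ih]
        omega
    refine ⟨fm, fun h x => ?_⟩
    change D h.length x = D ((h.foldl fm.upd fm.init : Fin (n + 1)) : ℕ) x
    rw [hfold]
    rcases le_total h.length n with hl | hl
    · rw [min_eq_left hl]
    · rw [min_eq_right hl, hDlarge _ _ hl, hDlarge _ _ le_rfl]
  · let st : ℕ → List (Conf Q C M) × Conf Q C M := fun i => ((List.range i).map c, c i)
    have hpos : ∀ m ≤ n, 0 < chainPathProb U.kernel (st 0)
        ((List.range m).map fun i => st (i + 1)) := by
      intro m hm
      induction m with
      | zero => simp [chainPathProb]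
      | succ m ih =>
        rw [List.range_succ, List.map_append, List.map_singleton, chainPathProb_append_singleton,
          getLastD_of_mem_chainCyl (mem_chainCyl_map_range st m)]
        refine ENNReal.mul_pos (ih (by omega)).ne' (Scheduler.kernel_ne_zero.2 ⟨?_, ?_⟩)
        · simp [st, List.range_succ]
        · have hchoose : U.choose (st m).1 (st m).2 = δ m := by
            simp only [U, D, st, List.length_map, List.length_range]
            exact if_pos ⟨by omega, trivial⟩
          simpa [hchoose, st] using hpath m (by omega)
    have hcyl : chainCyl (st 0) ((List.range n).map fun i => st (i + 1)) ⊆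
        {ω | ω 0 = st 0 ∧ ∃ i, U.kernel (ω i) (ω (i + 1)) = 0} ∪
          ({ω | (fun i => (ω i).2) ∈ evEvAlways (inLoc B)} ∩ {ω | ω 0 = st 0}) := by
      intro ω hω
      by_cases hbad : ∃ i, U.kernel (ω i) (ω (i + 1)) = 0
      · exact Or.inl ⟨hω.1, hbad⟩
      push Not at hbad
      have hstep := fun i => Scheduler.kernel_ne_zero.1 (hbad i)
      have hlen : ∀ i, (ω i).1.length = i := by
        intro i
        induction i with
        | zero => rw [hω.1]; rfl
        | succ i ih => rw [(hstep i).1, List.length_append, ih, List.length_singleton]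
      have hωn : ω n = st n := by
        have h1 := getLastD_of_mem_chainCyl hω
        rw [getLastD_of_mem_chainCyl (mem_chainCyl_map_range st n)] at h1
        simpa using h1.symm
      have hsafe : ∀ j, (ω (n + j)).2.1 ∈ N.L.Safe B := by
        intro j
        induction j with
        | zero => simpa [hωn, st] using ht
        | succ j ih =>
          have hdst := (hstep (n + j)).2.2.2.1
          have hch : U.choose (ω (n + j)).1 (ω (n + j)).2 = v (ω (n + j)).2.1 :=
            hDlarge _ _ (by rw [hlen]; omega)
          rw [hch] at hdst
          rw [← add_assoc, hdst]
          exact hvsafe _ ih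
      refine Or.inr ⟨⟨n, fun i hi => ?_⟩, hω.1⟩
      obtain ⟨j, rfl⟩ := Nat.exists_eq_add_of_le hi
      exact (N.L.isSafeFor_safe B).1 (hsafe j)
    calc 0 < chainOuter U.kernel (st 0) (chainCyl (st 0) ((List.range n).map fun i => st (i + 1))) :=
          (hpos n le_rfl).trans_eq (chainOuter_chainCyl U.tsum_kernel _ _).symm
      _ ≤ 0 + U.Pr (c 0) (evEvAlways (inLoc B)) := by
          refine ((MeasureTheory.measure_mono hcyl).trans (MeasureTheory.measure_union_le _ _)).trans ?_
          rw [chainOuter_impossible_step]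
          rfl
      _ = _ := zero_add _

end Main

/-- `◇□B` holds with positive probability under some scheduler iff it does
under some almost blind, finite-memory scheduler, iff `Safe(B)` is reachable
from `(q,ε)`. -/
theorem statement12 {Q C M : Type} [Fintype Q] [Fintype C] [DecidableEq C]
    [Fintype M] [DecidableEq M] (N : NPLCS Q C M) (q : Q) (B : Set Q) :
    ((∃ U : Scheduler N, 0 < U.Pr (q, eps C M) (evEvAlways (inLoc B))) ↔
      ∃ U : Scheduler N, U.AlmostBlind ∧ U.FiniteMemory ∧
        0 < U.Pr (q, eps C M) (evEvAlways (inLoc B)))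
    ∧ ((∃ U : Scheduler N, 0 < U.Pr (q, eps C M) (evEvAlways (inLoc B))) ↔
      ∃ t, N.L.Reach (q, eps C M) t ∧ t.1 ∈ N.L.Safe B) := by
  have reach_of_pos : (∃ U : Scheduler N, 0 < U.Pr (q, eps C M) (evEvAlways (inLoc B))) →
      ∃ t, N.L.Reach (q, eps C M) t ∧ t.1 ∈ N.L.Safe B := by
    rintro ⟨U, hU⟩
    by_contra! h
    exact hU.ne' (U.pr_evEvAlways_eq_zero _ B h)
  have pos_of_reach : (∃ t, N.L.Reach (q, eps C M) t ∧ t.1 ∈ N.L.Safe B) →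
      ∃ U : Scheduler N, U.AlmostBlind ∧ U.FiniteMemory ∧
        0 < U.Pr (q, eps C M) (evEvAlways (inLoc B)) :=
    fun ⟨_, ht, hsafe⟩ => N.exists_almostBlind_finiteMemory B ht hsafe
  exact ⟨⟨fun h => pos_of_reach (reach_of_pos h), fun ⟨U, _, _, hU⟩ => ⟨U, hU⟩⟩,
    reach_of_pos, fun h => let ⟨U, _, _, hU⟩ := pos_of_reach h; ⟨U, hU⟩⟩

end NPLCSmodel
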